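/- arXiv:2407.16345 — 2 statements merged into one kernel-verified Lean document; each statement's English description precedes it below -/
import Mathlib

section
/- Let n be a positive integer and N = 2n. For every k ∈ {1,...,N−1}, in the set [k]_N^even every number in {1,...,N} appears once and only once among the entries of its unordered pairs; in particular, different elements of [k]_N^even do not share a common number. -/
/-- `rep N p` is the unique representative of `p` modulo `N` lying in `{1,...,N}`
(so `rep N N = N` rather than `0`). -/
def rep (N p : ℤ) : ℤ := (p - 1) % N + 1

/-- The unordered pair `{[k-j]_N, [k+j]_N}`. -/
def oddPair (N k : ℤ) (j : ℕ) : Sym2 ℤ := s(rep N (k - j), rep N (k + j))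

/-- The scheduling set `[k]_{2n-1}^odd = { {[k-j]_{2n-1}, [k+j]_{2n-1}} : j = 0,...,n-1 }`. -/
def oddSet (n : ℕ) (k : ℤ) : Set (Sym2 ℤ) :=
  {e | ∃ j : ℕ, j < n ∧ e = oddPair (2 * (n : ℤ) - 1) k j}

/-- The scheduling set `[k]_{2n}^even`: for `k ∈ {1,...,2n-1}` it is
`([k]_{2n-1}^odd \ {{k,k}}) ∪ {{k,2n}}`, and for `k = 2n` it is `{ {j,j} : j = 1,...,2n }`. -/
def evenSet (n : ℕ) (k : ℤ) : Set (Sym2 ℤ) :=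
  if k = 2 * (n : ℤ) then {e | ∃ j : ℤ, 1 ≤ j ∧ j ≤ 2 * (n : ℤ) ∧ e = s(j, j)}
  else (oddSet n k \ {s(k, k)}) ∪ {s(k, (2 * (n : ℤ)))}

theorem rep_add_of_le {M k j : ℤ} (hk : 1 ≤ k) (hkM : k ≤ M) (hj : 0 ≤ j) (hjM : j < M) :
    rep M (k + j) = if k + j ≤ M then k + j else k + j - M := by
  unfold rep
  split_ifs with h
  · rw [Int.emod_eq_of_lt (by omega) (by omega)]
    omega
  · rw [← Int.sub_emod_right, Int.emod_eq_of_lt (by omega) (by omega)]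
    omega

theorem rep_sub_of_le {M k j : ℤ} (hk : 1 ≤ k) (hkM : k ≤ M) (hj : 0 ≤ j) (hjM : j < M) :
    rep M (k - j) = if 1 ≤ k - j then k - j else k - j + M := by
  unfold rep
  split_ifs with h
  · rw [Int.emod_eq_of_lt (by omega) (by omega)]
    omega
  · rw [← Int.add_emod_right, Int.emod_eq_of_lt (by omega) (by omega)]
    omega

/-- An explicit description of the pairs of `evenSet n k` when `k ≠ 2 * n`. -/
theorem mem_evenSet_iff {n : ℕ} {k : ℤ} (hk : 1 ≤ k) (hkn : k ≤ 2 * (n : ℤ) - 1)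
    {e : Sym2 ℤ} :
    e ∈ evenSet n k ↔ e = s(k, 2 * (n : ℤ)) ∨ ∃ j : ℕ, 1 ≤ j ∧ j < n ∧
      e = s(if 1 ≤ k - j then k - j else k - j + (2 * (n : ℤ) - 1),
        if k + j ≤ 2 * (n : ℤ) - 1 then k + j else k + j - (2 * (n : ℤ) - 1)) := by
  have pair_eq {j : ℕ} (hj : j < n) : oddPair (2 * (n : ℤ) - 1) k j =
      s(if 1 ≤ k - j then k - j else k - j + (2 * (n : ℤ) - 1),
        if k + j ≤ 2 * (n : ℤ) - 1 then k + j else k + j - (2 * (n : ℤ) - 1)) := by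
    rw [oddPair, rep_sub_of_le hk hkn (by omega) (by omega),
      rep_add_of_le hk hkn (by omega) (by omega)]
  rw [evenSet, if_neg (by omega)]
  simp only [oddSet, Set.mem_union, Set.mem_sdiff, Set.mem_ofPred_eq, Set.mem_singleton_iff]
  constructor
  · rintro (⟨⟨j, hj, rfl⟩, hne⟩ | rfl)
    · refine Or.inr ⟨j, ?_, hj, pair_eq hj⟩
      by_contra h
      obtain rfl : j = 0 := by omega
      refine hne ?_
      rw [pair_eq hj, if_pos (by omega), if_pos (by omega)]
      simp
    · exact Or.inl rfl
  · rintro (rfl | ⟨j, hj, hjn, rfl⟩)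
    · exact Or.inr rfl
    · refine Or.inl ⟨⟨j, hjn, (pair_eq hjn).symm⟩, fun h ↦ ?_⟩
      rw [Sym2.eq_iff] at h
      split_ifs at h <;> omega

/-- For `n ≥ 1`, `N = 2n` and `k ∈ {1,...,N-1}`, every number in `{1,...,N}` appears once and
only once among the entries of the unordered pairs of `[k]_N^even`: each `ℓ ∈ {1,...,N}` belongs
to exactly one pair of `[k]_N^even`, and no pair of `[k]_N^even` has two equal entries.
In particular, different elements of `[k]_N^even` do not share a common number. -/
theorem stmt2 (n : ℕ) (hn : 1 ≤ n) (N : ℤ) (hN : N = 2 * (n : ℤ))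
    (k : ℤ) (hk : k ∈ Set.Icc 1 (N - 1)) :
    (∀ ℓ : ℤ, ℓ ∈ Set.Icc 1 N → ∃! e : Sym2 ℤ, e ∈ evenSet n k ∧ ℓ ∈ e) ∧
      ∀ e ∈ evenSet n k, ¬ e.IsDiag := by
  subst hN
  obtain ⟨hk, hkn⟩ := hk
  refine ⟨fun ℓ ⟨hℓ, hℓn⟩ ↦ ?_, fun e he ↦ ?_⟩
  · refine existsUnique_of_exists_of_unique ?_ ?_
    · by_cases h : ℓ = k ∨ ℓ = 2 * (n : ℤ)
      · exact ⟨_, (mem_evenSet_iff hk hkn).2 (Or.inl rfl), by simpa using h⟩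
      · obtain ⟨j, hj, hjn, hjℓ⟩ : ∃ j : ℕ, 1 ≤ j ∧ j < n ∧ (ℓ = k - j ∨
            ℓ = k - j + (2 * (n : ℤ) - 1) ∨ ℓ = k + j ∨ ℓ = k + j - (2 * (n : ℤ) - 1)) := by
          rcases lt_or_ge ℓ k with h₁ | h₁
          · rcases lt_or_ge (k - ℓ) n with h₂ | h₂
            · exact ⟨(k - ℓ).toNat, by omega, by omega, by omega⟩
            · exact ⟨(2 * (n : ℤ) - 1 - (k - ℓ)).toNat, by omega, by omega, by omega⟩
          · rcases lt_or_ge (ℓ - k) n with h₂ | h₂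
            · exact ⟨(ℓ - k).toNat, by omega, by omega, by omega⟩
            · exact ⟨(2 * (n : ℤ) - 1 - (ℓ - k)).toNat, by omega, by omega, by omega⟩
        refine ⟨_, (mem_evenSet_iff hk hkn).2 (Or.inr ⟨j, hj, hjn, rfl⟩), ?_⟩
        rw [Sym2.mem_iff]
        split_ifs <;> omega
    · rintro e₁ e₂ ⟨he₁, hℓ₁⟩ ⟨he₂, hℓ₂⟩
      rw [mem_evenSet_iff hk hkn] at he₁ he₂
      rcases he₁ with rfl | ⟨i, hi, hin, rfl⟩ <;> rcases he₂ with rfl | ⟨j, hj, hjn, rfl⟩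
      · rfl
      · rw [Sym2.mem_iff] at hℓ₁ hℓ₂
        split_ifs at hℓ₂ <;> omega
      · rw [Sym2.mem_iff] at hℓ₁ hℓ₂
        split_ifs at hℓ₁ <;> omega
      · rw [Sym2.mem_iff] at hℓ₁ hℓ₂
        obtain rfl : i = j := by split_ifs at hℓ₁ hℓ₂ <;> omega
        rfl
  · rcases (mem_evenSet_iff hk hkn).1 he with rfl | ⟨j, hj, hjn, rfl⟩
    · rw [Sym2.mk_isDiag_iff]
      omega
    · rw [Sym2.mk_isDiag_iff]
      split_ifs <;> omega
end

section
/- Let n be a positive integer and N = 2n. For all k, k′ ∈ {1,...,N} with k ≠ k′, the sets [k]_N^even and [k′]_N^even are disjoint. -/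
theorem one_le_rep {N : ℤ} (hN : 0 < N) (p : ℤ) : 1 ≤ rep N p := by
  have := Int.emod_nonneg (p - 1) hN.ne'
  unfold rep
  omega

theorem rep_le {N : ℤ} (hN : 0 < N) (p : ℤ) : rep N p ≤ N := by
  have := Int.emod_lt_of_pos (p - 1) hN
  unfold rep
  omega

theorem dvd_rep_sub (N p : ℤ) : N ∣ rep N p - p := by
  refine ⟨-((p - 1) / N), ?_⟩
  have := Int.emod_add_mul_ediv (p - 1) N
  unfold rep
  linarith

/-- Doubling is injective on `{1,...,2n-1}` modulo `2n-1`. -/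
theorem eq_of_dvd_two_mul_sub {n k l : ℤ} (hk : 1 ≤ k) (hk' : k ≤ 2 * n - 1) (hl : 1 ≤ l)
    (hl' : l ≤ 2 * n - 1) (h : 2 * n - 1 ∣ 2 * (k - l)) : k = l := by
  have h1 : 2 * n - 1 ∣ k - l := by
    obtain ⟨c, hc⟩ := h
    exact ⟨n * c - (k - l), by linear_combination n * hc⟩
  have h3 := Int.eq_zero_of_abs_lt_dvd h1 (abs_lt.2 ⟨by omega, by omega⟩)
  omega

theorem exists_of_mem_oddSet {n : ℕ} (hn : 1 ≤ n) {k : ℤ} {e : Sym2 ℤ} (he : e ∈ oddSet n k) :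
    ∃ a b : ℤ, e = s(a, b) ∧ 1 ≤ a ∧ a ≤ 2 * n - 1 ∧ 1 ≤ b ∧ b ≤ 2 * n - 1 ∧
      2 * (n : ℤ) - 1 ∣ a + b - 2 * k := by
  obtain ⟨j, -, rfl⟩ := he
  have hM : 0 < 2 * (n : ℤ) - 1 := by omega
  refine ⟨_, _, rfl, one_le_rep hM _, rep_le hM _, one_le_rep hM _, rep_le hM _, ?_⟩
  obtain ⟨c, hc⟩ := dvd_rep_sub (2 * (n : ℤ) - 1) (k - j)
  obtain ⟨d, hd⟩ := dvd_rep_sub (2 * (n : ℤ) - 1) (k + j)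
  exact ⟨c + d, by linear_combination hc + hd⟩

theorem exists_of_mem_evenSet {n : ℕ} (hn : 1 ≤ n) {k : ℤ} (hk : 1 ≤ k) (hk' : k ≤ 2 * n - 1)
    {e : Sym2 ℤ} (he : e ∈ evenSet n k) :
    ∃ a b : ℤ, e = s(a, b) ∧ a ≠ b ∧ 1 ≤ a ∧ a ≤ 2 * n - 1 ∧
      (b = 2 * n ∧ a = k ∨ b ≤ 2 * n - 1 ∧ 2 * (n : ℤ) - 1 ∣ a + b - 2 * k) := by
  rw [evenSet, if_neg (by omega)] at he
  rcases he with ⟨he, hne⟩ | rfl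
  · obtain ⟨a, b, rfl, ha, ha', -, hb', h⟩ := exists_of_mem_oddSet hn he
    refine ⟨a, b, rfl, ?_, ha, ha', Or.inr ⟨hb', h⟩⟩
    rintro rfl
    have : a = k := eq_of_dvd_two_mul_sub ha ha' hk hk' (by rwa [mul_sub, two_mul a])
    exact hne (by rw [this]; rfl)
  · exact ⟨k, _, rfl, by omega, hk, hk', Or.inl ⟨rfl, rfl⟩⟩

theorem not_isDiag_of_mem_evenSet {n : ℕ} (hn : 1 ≤ n) {k : ℤ} (hk : 1 ≤ k)
    (hk' : k ≤ 2 * n - 1) {e : Sym2 ℤ} (he : e ∈ evenSet n k) : ¬ e.IsDiag := by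
  obtain ⟨a, b, rfl, hab, -⟩ := exists_of_mem_evenSet hn hk hk' he
  simpa using hab

theorem isDiag_of_mem_evenSet_self {n : ℕ} {e : Sym2 ℤ} (he : e ∈ evenSet n (2 * n)) :
    e.IsDiag := by
  rw [evenSet, if_pos rfl] at he
  obtain ⟨j, -, -, rfl⟩ := he
  simp

/-- For `n ≥ 1`, `N = 2n`, and `k ≠ k'` in `{1,...,N}`, the sets `[k]_N^even` and
`[k']_N^even` are disjoint. -/
theorem stmt3 (n : ℕ) (hn : 1 ≤ n) (N : ℤ) (hN : N = 2 * (n : ℤ))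
    (k k' : ℤ) (hk : k ∈ Set.Icc 1 N) (hk' : k' ∈ Set.Icc 1 N) (hne : k ≠ k') :
    Disjoint (evenSet n k) (evenSet n k') := by
  subst hN
  obtain ⟨hk1, hk2⟩ := hk
  obtain ⟨hk1', hk2'⟩ := hk'
  rw [Set.disjoint_left]
  intro e he he'
  by_cases hkN : k = 2 * (n : ℤ)
  · subst hkN
    exact not_isDiag_of_mem_evenSet hn hk1' (by omega) he' (isDiag_of_mem_evenSet_self he)
  by_cases hkN' : k' = 2 * (n : ℤ)
  · subst hkN'
    exact not_isDiag_of_mem_evenSet hn hk1 (by omega) he (isDiag_of_mem_evenSet_self he')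
  obtain ⟨a, b, rfl, -, -, ha, h⟩ := exists_of_mem_evenSet hn hk1 (by omega) he
  obtain ⟨c, d, hcd, -, -, hc, h'⟩ := exists_of_mem_evenSet hn hk1' (by omega) he'
  have hcd := Sym2.eq_iff.1 hcd
  rcases h with ⟨hb, rfl⟩ | ⟨hb, h⟩ <;> rcases h' with ⟨hd, rfl⟩ | ⟨hd, h'⟩
  · omega
  · omega
  · omega
  · have hsum : c + d = a + b := by omega
    rw [hsum] at h'
    refine hne (eq_of_dvd_two_mul_sub (n := n) hk1 (by omega) hk1' (by omega) ?_)
    obtain ⟨x, hx⟩ := h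
    obtain ⟨y, hy⟩ := h'
    exact ⟨y - x, by linear_combination hy - hx⟩
end
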